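/- arXiv:2405.11923 — 2 statements merged into one kernel-verified Lean document; each statement's English description precedes it below -/
import Mathlib

section
/- Explicit infinite-T lower bound for s-sparse mean estimation (the lower bound of Proposition 2, non-interactive case, with explicit constants). Let d ≥ 2 and 1 ≤ s ≤ d be integers, and let α > 0 and n ≥ 1 satisfy n·min{α,α²} > 120·s·log(6d). Let Θ_{d,s} = {θ ∈ ℝ^d : max_j |θ_j| ≤ 1 and at most s coordinates of θ are nonzero}. Then for every measurable space Z, every family of Markov kernels Q_1, …, Q_n from ℝ^d to Z, each α-LDP on Θ_{d,s}, and every measurable estimator θ̂ : Z^n → ℝ^d, there exists θ ∈ Θ_{d,s} such that ∫ ‖θ̂(z) − θ‖₂² d(⊗_{i=1}^n Q_i(θ))(z) ≥ (1/4)·( 2·(20s)^{1/2}·d^{−1}·exp(24·n·min{α,α²}/s + log(4)/s) + 4 )^{−2}. -/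
open MeasureTheory Real
open scoped ENNReal

/-- A mechanism, given as a (measurable) family of probability measures, is `α`-LDP on `D`. -/
def IsLDPOn {X Z : Type*} [MeasurableSpace X] [MeasurableSpace Z]
    (Q : X → Measure Z) (α : ℝ) (D : Set X) : Prop :=
  ∀ S : Set Z, MeasurableSet S → ∀ x ∈ D, ∀ x' ∈ D,
    Q x S ≤ ENNReal.ofReal (Real.exp α) * Q x' S

open Function

/-- Mutual domination by the factor `exp α` bounds the second moment of the likelihood ratio. -/
lemma lintegral_rnDeriv_sq_le {Z : Type*} [MeasurableSpace Z] (p q : Measure Z)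
    [IsProbabilityMeasure p] [IsProbabilityMeasure q] {α : ℝ} (hα : 0 ≤ α)
    (hpq : ∀ S, MeasurableSet S → p S ≤ ENNReal.ofReal (exp α) * q S)
    (hqp : ∀ S, MeasurableSet S → q S ≤ ENNReal.ofReal (exp α) * p S) :
    ∫⁻ z, p.rnDeriv q z ^ 2 ∂q ≤ ENNReal.ofReal (exp (min α (α ^ 2))) := by
  have hac : p ≪ q := Measure.AbsolutelyContinuous.mk fun S hS h0 => by
    simpa [h0] using hpq S hS
  have hL : Measurable (p.rnDeriv q) := Measure.measurable_rnDeriv p q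
  have hup : p.rnDeriv q ≤ᵐ[q] fun _ => ENNReal.ofReal (exp α) := by
    refine ae_le_of_forall_setLIntegral_le_of_sigmaFinite hL fun S hS _ => ?_
    rw [Measure.setLIntegral_rnDeriv hac, setLIntegral_const]
    exact hpq S hS
  have hlow : (fun _ => 1) ≤ᵐ[q] fun z => ENNReal.ofReal (exp α) * p.rnDeriv q z := by
    refine ae_le_of_forall_setLIntegral_le_of_sigmaFinite measurable_const fun S hS _ => ?_
    rw [lintegral_const_mul _ hL, Measure.setLIntegral_rnDeriv hac, setLIntegral_const, one_mul]
    exact hqp S hS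
  have hpt : ∀ᵐ z ∂q, p.rnDeriv q z ^ 2 + 1
      ≤ ENNReal.ofReal (exp α + exp (-α)) * p.rnDeriv q z := by
    filter_upwards [hup, hlow] with z h1 h2
    have hfin : p.rnDeriv q z ≠ ⊤ := ne_top_of_le_ne_top ENNReal.ofReal_ne_top h1
    obtain ⟨x, hx0, hx⟩ : ∃ x : ℝ, 0 ≤ x ∧ p.rnDeriv q z = ENNReal.ofReal x :=
      ⟨_, ENNReal.toReal_nonneg, (ENNReal.ofReal_toReal hfin).symm⟩
    rw [hx] at h1 h2 ⊢
    rw [← ENNReal.ofReal_mul (exp_pos α).le, ← ENNReal.ofReal_one,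
      ENNReal.ofReal_le_ofReal_iff (by positivity)] at h2
    rw [ENNReal.ofReal_le_ofReal_iff (exp_pos α).le] at h1
    rw [← ENNReal.ofReal_pow hx0, ← ENNReal.ofReal_mul (by positivity), ← ENNReal.ofReal_one,
      ← ENNReal.ofReal_add (by positivity) zero_le_one]
    refine ENNReal.ofReal_le_ofReal ?_
    have h3 : exp (-α) * exp α = 1 := by rw [← Real.exp_add]; simp
    have h4 : exp (-α) ≤ x := by
      have := mul_le_mul_of_nonneg_left h2 (exp_pos (-α)).le
      rwa [← mul_assoc, h3, one_mul, mul_one] at this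
    nlinarith [mul_nonneg (sub_nonneg.2 h1) (sub_nonneg.2 h4)]
  have hint : (∫⁻ z, p.rnDeriv q z ^ 2 ∂q) + 1 ≤ ENNReal.ofReal (exp α + exp (-α)) := by
    have := lintegral_mono_ae hpt
    rwa [lintegral_add_right _ measurable_const, lintegral_const_mul _ hL,
      Measure.lintegral_rnDeriv hac, lintegral_one, measure_univ, measure_univ, mul_one] at this
  have hexp : exp α + exp (-α) ≤ exp (min α (α ^ 2)) + 1 := by
    rcases min_choice α (α ^ 2) with h | h <;> rw [h]
    · have : exp (-α) ≤ 1 := exp_le_one_iff.2 (by linarith)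
      linarith
    · have h1 := cosh_le_exp_half_sq α
      rw [cosh_eq] at h1
      have h2 : exp (α ^ 2) = exp (α ^ 2 / 2) ^ 2 := by
        rw [← Real.exp_nat_mul]; congr 1; push_cast; ring
      nlinarith [sq_nonneg (exp (α ^ 2 / 2) - 1)]
  refine ENNReal.le_of_add_le_add_right ENNReal.one_ne_top (hint.trans ?_)
  rw [← ENNReal.ofReal_one, ← ENNReal.ofReal_add (by positivity) zero_le_one]
  exact ENNReal.ofReal_le_ofReal hexp

lemma sq_lintegral_mul_le {Z : Type*} [MeasurableSpace Z] (q : Measure Z)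
    {f g : Z → ℝ≥0∞} (hf : Measurable f) (hg : Measurable g) :
    (∫⁻ z, f z * g z ∂q) ^ 2 ≤ (∫⁻ z, f z ^ 2 ∂q) * ∫⁻ z, g z ^ 2 ∂q := by
  have h := ENNReal.lintegral_mul_le_Lp_mul_Lq q Real.HolderConjugate.two_two
    hf.aemeasurable hg.aemeasurable
  have hsq : ∀ x : ℝ≥0∞, (x ^ (1 / 2 : ℝ)) ^ 2 = x := fun x => by
    rw [← ENNReal.rpow_natCast, ← ENNReal.rpow_mul]; norm_num
  have h2 := pow_le_pow_left' h 2
  rw [mul_pow, hsq, hsq] at h2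
  simpa using h2

lemma sq_lintegral_le_of_dominated {Z : Type*} [MeasurableSpace Z] (p q : Measure Z)
    [IsProbabilityMeasure p] [IsProbabilityMeasure q] {α : ℝ} (hα : 0 ≤ α)
    (hpq : ∀ S, MeasurableSet S → p S ≤ ENNReal.ofReal (exp α) * q S)
    (hqp : ∀ S, MeasurableSet S → q S ≤ ENNReal.ofReal (exp α) * p S)
    {f : Z → ℝ≥0∞} (hf : Measurable f) :
    (∫⁻ z, f z ∂p) ^ 2 ≤ ENNReal.ofReal (exp (min α (α ^ 2))) * ∫⁻ z, f z ^ 2 ∂q := by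
  have hac : p ≪ q := Measure.AbsolutelyContinuous.mk fun S hS h0 => by
    simpa [h0] using hpq S hS
  rw [← lintegral_rnDeriv_mul hac hf.aemeasurable]
  exact (sq_lintegral_mul_le q (Measure.measurable_rnDeriv p q) hf).trans
    (mul_le_mul_left (lintegral_rnDeriv_sq_le p q hα hpq hqp) _)

/-- Second-moment comparisons tensorize over finite products. -/
lemma sq_lintegral_pi_le {Z : Type*} [MeasurableSpace Z] {C : ℝ≥0∞} {n : ℕ}
    (p q : Fin n → Measure Z) [∀ i, IsProbabilityMeasure (p i)]
    [∀ i, IsProbabilityMeasure (q i)]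
    (h : ∀ i (f : Z → ℝ≥0∞), Measurable f → (∫⁻ z, f z ∂p i) ^ 2 ≤ C * ∫⁻ z, f z ^ 2 ∂q i)
    {f : (Fin n → Z) → ℝ≥0∞} (hf : Measurable f) :
    (∫⁻ z, f z ∂Measure.pi p) ^ 2 ≤ C ^ n * ∫⁻ z, f z ^ 2 ∂Measure.pi q := by
  induction n with
  | zero =>
    rw [Measure.pi_of_empty p, Measure.pi_of_empty q, lintegral_dirac' _ hf,
      lintegral_dirac' _ (hf.pow_const 2), pow_zero, one_mul]
  | succ n ih =>
    let e := MeasurableEquiv.piFinSuccAbove (fun _ : Fin (n + 1) => Z) 0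
    let g : Z × (Fin n → Z) → ℝ≥0∞ := fun w => f (e.symm w)
    have hg : Measurable g := hf.comp e.symm.measurable
    have key : ∀ (r : Fin (n + 1) → Measure Z) [∀ i, IsProbabilityMeasure (r i)]
        (φ : Z × (Fin n → Z) → ℝ≥0∞), Measurable φ → ∫⁻ z, φ (e z) ∂Measure.pi r
          = ∫⁻ x, ∫⁻ y, φ (x, y) ∂Measure.pi (fun j => r (Fin.succ j)) ∂r 0 := by
      intro r _ φ hφ
      rw [(measurePreserving_piFinSuccAbove r 0).lintegral_comp hφ,
        lintegral_prod _ hφ.aemeasurable]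
      rfl
    have hfg : ∀ z, f z = g (e z) := fun z => by simp [g]
    simp_rw [hfg]
    rw [key p g hg, key q (fun w => g w ^ 2) (hg.pow_const 2)]
    calc _ ≤ C * ∫⁻ x, (∫⁻ y, g (x, y) ∂Measure.pi (fun j => p (Fin.succ j))) ^ 2 ∂q 0 :=
          h 0 _ hg.lintegral_prod_right'
      _ ≤ C * ∫⁻ x, C ^ n * ∫⁻ y, g (x, y) ^ 2 ∂Measure.pi (fun j => q (Fin.succ j)) ∂q 0 := by
          gcongr with x
          exact ih _ _ (fun i => h _) (hg.comp measurable_prodMk_left)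
      _ = _ := by
          rw [lintegral_const_mul _ (hg.pow_const 2).lintegral_prod_right', pow_succ', mul_assoc]

/-- Among sufficiently many disjoint events, one has probability at most one half under its own
hypothesis. -/
lemma exists_measure_le_half {Ω J : Type*} [MeasurableSpace Ω] [Fintype J] [Nonempty J]
    (P : J → Measure Ω) (P₀ : Measure Ω) [IsProbabilityMeasure P₀] {C : ℝ≥0∞}
    (A : J → Set Ω) (hA : ∀ j, MeasurableSet (A j)) (hdisj : Pairwise (Disjoint on A))
    (hP : ∀ j, P j (A j) ^ 2 ≤ C * P₀ (A j)) (hC : 4 * C ≤ Fintype.card J) :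
    ∃ j, P j (A j) ≤ 1 / 2 := by
  by_contra! hcon
  have h1 : ∀ j, (1 / 4 : ℝ≥0∞) < C * P₀ (A j) := fun j => by
    refine lt_of_lt_of_le ?_ (hP j)
    have : (1 / 4 : ℝ≥0∞) = (1 / 2) ^ 2 := by
      simp only [one_div]
      rw [← ENNReal.inv_pow]
      norm_num
    rw [this]
    exact ENNReal.pow_lt_pow_left two_ne_zero (hcon j)
  have h2 : ∑ _j : J, (1 / 4 : ℝ≥0∞) < ∑ j, C * P₀ (A j) :=
    ENNReal.sum_lt_sum_of_nonempty Finset.univ_nonempty fun j _ => h1 j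
  have h3 : ∑ j, P₀ (A j) ≤ 1 := by
    have := sum_measure_le_measure_univ (μ := P₀) (s := Finset.univ) (t := A)
      (fun j _ => (hA j).nullMeasurableSet) (fun i _ j _ hij => (hdisj hij).aedisjoint)
    simpa using this
  rw [← Finset.mul_sum, Finset.sum_const, Finset.card_univ, nsmul_eq_mul, one_div,
    ← div_eq_mul_inv] at h2
  have h4 : (Fintype.card J : ℝ≥0∞) / 4 < C :=
    h2.trans_le ((mul_le_mul_right h3 C).trans_eq (mul_one C))
  have h5 : C ≤ (Fintype.card J : ℝ≥0∞) / 4 := by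
    rw [ENNReal.le_div_iff_mul_le (by simp) (by simp), mul_comm]
    exact hC
  exact absurd h4 h5.not_gt

/-- Reduction from estimation to multiple testing over a separated family. -/
lemma exists_sq_risk_ge {Ω J E : Type*} [MeasurableSpace Ω] [Fintype J] [Nonempty J]
    [NormedAddCommGroup E] [MeasurableSpace E] [BorelSpace E]
    (P : J → Measure Ω) [∀ j, IsProbabilityMeasure (P j)]
    (P₀ : Measure Ω) [IsProbabilityMeasure P₀] {C : ℝ≥0∞}
    (hP : ∀ j A, MeasurableSet A → P j A ^ 2 ≤ C * P₀ A) (hC : 4 * C ≤ Fintype.card J)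
    (θ : J → E) {r : ℝ} (hr : 0 ≤ r) (hsep : ∀ i j, i ≠ j → 2 * r ≤ dist (θ i) (θ j))
    {T : Ω → E} (hT : Measurable T) :
    ∃ j, ENNReal.ofReal (r ^ 2 / 2) ≤ ∫⁻ z, ENNReal.ofReal (‖T z - θ j‖ ^ 2) ∂P j := by
  let A : J → Set Ω := fun j => T ⁻¹' Metric.ball (θ j) r
  have hA : ∀ j, MeasurableSet (A j) := fun j => hT Metric.isOpen_ball.measurableSet
  have hdisj : Pairwise (Disjoint on A) := fun i j hij =>
    (Metric.ball_disjoint_ball (by linarith [hsep i j hij])).preimage T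
  obtain ⟨j, hj⟩ := exists_measure_le_half P P₀ A hA hdisj (fun j => hP j _ (hA j)) hC
  refine ⟨j, ?_⟩
  have hcompl : (2⁻¹ : ℝ≥0∞) ≤ P j (A j)ᶜ := by
    rw [prob_compl_eq_one_sub (hA j), ← ENNReal.one_sub_inv_two]
    exact tsub_le_tsub_left (by simpa using hj) 1
  calc ENNReal.ofReal (r ^ 2 / 2) = ENNReal.ofReal (r ^ 2) * 2⁻¹ := by
        rw [ENNReal.ofReal_div_of_pos two_pos, div_eq_mul_inv]; norm_num
    _ ≤ ENNReal.ofReal (r ^ 2) * P j (A j)ᶜ := by gcongr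
    _ = ∫⁻ _ in (A j)ᶜ, ENNReal.ofReal (r ^ 2) ∂P j := by rw [setLIntegral_const]
    _ ≤ ∫⁻ z in (A j)ᶜ, ENNReal.ofReal (‖T z - θ j‖ ^ 2) ∂P j := by
        refine setLIntegral_mono' (hA j).compl fun z hz => ?_
        have : r ≤ ‖T z - θ j‖ := by
          simpa [A, dist_eq_norm] using hz
        gcongr
    _ ≤ _ := setLIntegral_le_lintegral _ _

/-- The point of the grid of mesh `1 / k` in `ℝ ^ s` with index `a`, extended by zero to `ℝ ^ d`. -/
noncomputable def gridPoint (d : ℕ) {s k : ℕ} (a : Fin s → Fin k) : EuclideanSpace ℝ (Fin d) :=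
  WithLp.toLp 2 fun j => if h : (j : ℕ) < s then ((a ⟨j, h⟩ : ℕ) : ℝ) / k else 0

lemma abs_gridPoint_le_one {d s k : ℕ} (a : Fin s → Fin k) (j : Fin d) :
    |gridPoint d a j| ≤ 1 := by
  simp only [gridPoint]
  split_ifs with h
  · rw [abs_of_nonneg (by positivity)]
    refine div_le_one_of_le₀ ?_ (by positivity)
    exact_mod_cast (a ⟨j, h⟩).isLt.le
  · simp

lemma ncard_support_gridPoint_le {d s k : ℕ} (a : Fin s → Fin k) :
    {j | gridPoint d a j ≠ 0}.ncard ≤ s := by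
  have hmaps : ∀ j ∈ {j | gridPoint d a j ≠ 0}, (j : ℕ) ∈ Set.Iio s := fun j hj => by
    by_contra hjs
    exact hj (by simp only [gridPoint]; rw [dif_neg (by simpa using hjs)])
  have := Set.ncard_le_ncard_of_injOn (t := Set.Iio s) (fun j : Fin d => (j : ℕ)) hmaps
    (Fin.val_injective.injOn) (Set.finite_Iio s)
  simpa using this

lemma inv_le_dist_gridPoint {d s k : ℕ} (hsd : s ≤ d) {a b : Fin s → Fin k} (hab : a ≠ b) :
    (k : ℝ)⁻¹ ≤ dist (gridPoint d a) (gridPoint d b) := by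
  obtain ⟨i, hi⟩ := Function.ne_iff.1 hab
  let j : Fin d := ⟨i, i.isLt.trans_le hsd⟩
  have hcoord : ∀ c : Fin s → Fin k, gridPoint d c j = ((c i : ℕ) : ℝ) / k := fun c => by
    simp [gridPoint, j]
  have h1 : ‖(gridPoint d a - gridPoint d b) j‖ ≤ ‖gridPoint d a - gridPoint d b‖ :=
    PiLp.norm_apply_le _ j
  rw [dist_eq_norm]
  refine le_trans ?_ h1
  rw [PiLp.sub_apply, hcoord, hcoord, ← sub_div, norm_div, Real.norm_natCast, inv_eq_one_div]
  gcongr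
  have hne : ((a i : ℕ) : ℤ) - (b i : ℕ) ≠ 0 := fun h => hi (Fin.ext (by omega))
  rw [Real.norm_eq_abs]
  exact_mod_cast Int.one_le_abs hne

/-- The target rate is dominated by the squared grid radius. -/
lemma rate_le_sq_grid_radius {d s : ℕ} {m : ℝ} (hd : 2 ≤ d) (hs : 1 ≤ s)
    (hm : 120 * (s : ℝ) * log (6 * d) < m) {k : ℕ} (hk0 : 0 < k)
    (hk : (k : ℝ) ≤ exp (m / s + log 4 / s) + 1) :
    (1 / 4) * (2 * √(20 * s) / d * exp (24 * m / s + log 4 / s) + 4)⁻¹ ^ 2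
      ≤ (1 / (2 * k : ℝ)) ^ 2 / 2 := by
  have hd' : (2 : ℝ) ≤ d := by exact_mod_cast hd
  have hs' : (1 : ℝ) ≤ s := by exact_mod_cast hs
  have hk' : (0 : ℝ) < k := by exact_mod_cast hk0
  have hlog : 0 < log (6 * d) := log_pos (by linarith)
  have hms : 120 * log (6 * d) < m / s := by
    rw [lt_div_iff₀ (by linarith)]; linarith
  set E := exp (m / s + log 4 / s)
  have hE1 : 1 ≤ E := one_le_exp (add_nonneg (by linarith) (by positivity))
  have hbig : 6 * d * E ≤ exp (24 * m / s + log 4 / s) := by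
    have : 24 * m / s + log 4 / s = 23 * (m / s) + (m / s + log 4 / s) := by ring
    rw [this, Real.exp_add]
    refine mul_le_mul_of_nonneg_right ?_ (exp_pos _).le
    rw [← exp_log (show (0 : ℝ) < 6 * d by linarith)]
    exact exp_le_exp.2 (by linarith)
  have hsqrt : 1 ≤ √(20 * s) := Real.one_le_sqrt.2 (by linarith)
  have hX : 2 * (k : ℝ) ≤ 2 * √(20 * s) / d * exp (24 * m / s + log 4 / s) + 4 := by
    have h1 : 2 * 1 / d * (6 * d * E)
        ≤ 2 * √(20 * s) / d * exp (24 * m / s + log 4 / s) := by gcongr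
    have h2 : 2 * 1 / (d : ℝ) * (6 * d * E) = 12 * E := by field_simp; ring
    linarith
  calc _ ≤ (1 / 4) * (2 * (k : ℝ))⁻¹ ^ 2 := by gcongr
    _ ≤ _ := by
      rw [inv_eq_one_div]
      nlinarith [sq_nonneg (1 / (2 * (k : ℝ)))]

/-- Explicit infinite-`T` lower bound for `s`-sparse mean estimation
(the lower bound of Proposition 2, non-interactive case, with explicit constants). -/
theorem sparse_mean_infiniteT_lower
    {Z : Type*} [MeasurableSpace Z]
    (d s n : ℕ) (hd : 2 ≤ d) (hs1 : 1 ≤ s) (hsd : s ≤ d) (hn : 1 ≤ n)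
    (α : ℝ) (hα : 0 < α)
    (h : 120 * (s : ℝ) * Real.log (6 * d) < (n : ℝ) * min α (α ^ 2))
    (Q : Fin n → EuclideanSpace ℝ (Fin d) → Measure Z)
    (hQmeas : ∀ i, Measurable (Q i)) (hQprob : ∀ i θ, IsProbabilityMeasure (Q i θ))
    (hQLDP : ∀ i, IsLDPOn (Q i) α
      {θ : EuclideanSpace ℝ (Fin d) | (∀ j, |θ j| ≤ 1) ∧ {j | θ j ≠ 0}.ncard ≤ s})
    (θhat : (Fin n → Z) → EuclideanSpace ℝ (Fin d)) (hθhat : Measurable θhat) :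
    ∃ θ ∈ {θ : EuclideanSpace ℝ (Fin d) | (∀ j, |θ j| ≤ 1) ∧ {j | θ j ≠ 0}.ncard ≤ s},
      ENNReal.ofReal ((1 / 4) *
          (2 * Real.sqrt (20 * s) / d *
              Real.exp (24 * (n : ℝ) * min α (α ^ 2) / s + Real.log 4 / s) + 4)⁻¹ ^ 2)
        ≤ ∫⁻ z, ENNReal.ofReal (‖θhat z - θ‖ ^ 2) ∂(Measure.pi fun i : Fin n => Q i θ) := by
  set Θ : Set (EuclideanSpace ℝ (Fin d)) :=
    {θ | (∀ j, |θ j| ≤ 1) ∧ {j | θ j ≠ 0}.ncard ≤ s}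
  set m : ℝ := n * min α (α ^ 2) with hm
  have hs0 : (s : ℝ) ≠ 0 := by positivity
  let k : ℕ := ⌈exp (m / s + log 4 / s)⌉₊
  have hk0 : 0 < k := Nat.ceil_pos.2 (exp_pos _)
  have hkle : (k : ℝ) ≤ exp (m / s + log 4 / s) + 1 := (Nat.ceil_lt_add_one (exp_pos _).le).le
  have hkge : exp (m / s + log 4 / s) ≤ k := Nat.le_ceil _
  have : NeZero k := ⟨hk0.ne'⟩
  have hθ : ∀ a : Fin s → Fin k, gridPoint d a ∈ Θ := fun a =>
    ⟨abs_gridPoint_le_one a, ncard_support_gridPoint_le a⟩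
  have hC : 4 * ENNReal.ofReal (exp (min α (α ^ 2))) ^ n ≤ Fintype.card (Fin s → Fin k) := by
    have h1 : 4 * exp (min α (α ^ 2)) ^ n ≤ (k : ℝ) ^ s := by
      calc 4 * exp (min α (α ^ 2)) ^ n = exp (m / s + log 4 / s) ^ s := by
            rw [← Real.exp_nat_mul, ← Real.exp_nat_mul, mul_add, mul_div_cancel₀ _ hs0,
              mul_div_cancel₀ _ hs0, Real.exp_add, exp_log (by norm_num), mul_comm, hm]
        _ ≤ (k : ℝ) ^ s := by gcongr
    have h2 := ENNReal.ofReal_le_ofReal h1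
    rw [ENNReal.ofReal_mul (by norm_num), ENNReal.ofReal_pow (exp_pos _).le,
      ENNReal.ofReal_pow (Nat.cast_nonneg k), ENNReal.ofReal_natCast] at h2
    simpa using h2
  have hP : ∀ (a : Fin s → Fin k) (A : Set (Fin n → Z)), MeasurableSet A →
      (Measure.pi fun i => Q i (gridPoint d a)) A ^ 2
        ≤ ENNReal.ofReal (exp (min α (α ^ 2))) ^ n
          * (Measure.pi fun i => Q i (gridPoint d (0 : Fin s → Fin k))) A := by
    intro a A hA
    have h1 := sq_lintegral_pi_le (C := ENNReal.ofReal (exp (min α (α ^ 2))))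
      (fun i => Q i (gridPoint d a)) (fun i => Q i (gridPoint d (0 : Fin s → Fin k)))
      (fun i f hf => sq_lintegral_le_of_dominated _ _ hα.le
        (fun S hS => hQLDP i S hS _ (hθ a) _ (hθ 0))
        (fun S hS => hQLDP i S hS _ (hθ 0) _ (hθ a)) hf)
      (f := A.indicator 1) (measurable_one.indicator hA)
    have h2 : ∀ z, A.indicator (1 : (Fin n → Z) → ℝ≥0∞) z ^ 2 = A.indicator 1 z := fun z => by
      by_cases hz : z ∈ A <;> simp [hz]
    simp_rw [h2] at h1
    simpa only [lintegral_indicator_one hA] using h1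
  obtain ⟨a, ha⟩ := exists_sq_risk_ge
    (fun a : Fin s → Fin k => Measure.pi fun i => Q i (gridPoint d a)) _ hP hC
    (gridPoint d) (r := 1 / (2 * k : ℝ)) (by positivity)
    (fun a b hab => by
      refine le_of_eq_of_le ?_ (inv_le_dist_gridPoint hsd hab)
      field_simp) hθhat
  refine ⟨gridPoint d a, hθ a, le_trans (ENNReal.ofReal_le_ofReal ?_) ha⟩
  rw [mul_assoc 24, ← hm]
  exact rate_le_sq_grid_radius hd hs1 (by rw [hm]; exact h) hk0 hkle
end

section
/- Lemma C.6. For every real number x > 0 and every natural number n, (4·e^{x/2}/(1 + e^{x/2})²)^n ≤ exp(−n·min{x, x²}/20). -/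
theorem Real.sq_add_four_mul_exp_le (x : ℝ) (hx : 0 ≤ x) :
    (x ^ 2 / 4 + 4) * Real.exp (x / 2) ≤ (1 + Real.exp (x / 2)) ^ 2 := by
  have hs : x / 4 ≤ Real.sinh (x / 4) := Real.self_le_sinh_iff.2 (by linarith)
  have hsq : (x / 4) ^ 2 ≤ Real.sinh (x / 4) ^ 2 := pow_le_pow_left₀ (by linarith) hs 2
  have hE : Real.exp (x / 2) = Real.exp (x / 4) ^ 2 := by
    rw [← Real.exp_nat_mul]; congr 1; push_cast; ring
  have hmul : Real.exp (x / 4) * Real.exp (-(x / 4)) = 1 := by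
    rw [← Real.exp_add]; simp
  have key : 4 * Real.exp (x / 4) ^ 2 * Real.sinh (x / 4) ^ 2 =
      (Real.exp (x / 4) ^ 2 - 1) ^ 2 := by
    rw [Real.sinh_eq, ← hmul]; ring
  rw [hE]
  nlinarith [mul_le_mul_of_nonneg_left hsq (sq_nonneg (Real.exp (x / 4)))]

theorem Real.exp_le_one_add_five_quarters_mul {s : ℝ} (h0 : 0 ≤ s) (h1 : s ≤ 1 / 5) :
    Real.exp s ≤ 1 + 5 / 4 * s := by
  have h := Real.add_one_le_exp (-s)
  have hmul : Real.exp s * Real.exp (-s) = 1 := by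
    rw [← Real.exp_add]; simp
  have hle : Real.exp s * (1 - s) ≤ 1 := by
    nlinarith [mul_le_mul_of_nonneg_left h (Real.exp_pos s).le]
  have : Real.exp s * (1 - s) ≤ (1 + 5 / 4 * s) * (1 - s) := by nlinarith
  exact le_of_mul_le_mul_right this (by linarith)

theorem four_mul_pow_eleven_le {w : ℝ} (hw : 21 / 20 ≤ w) :
    4 * w ^ 11 ≤ (1 + w ^ 10) ^ 2 := by
  obtain ⟨v, rfl⟩ : ∃ v, w = 21 / 20 + v := ⟨w - 21 / 20, by ring⟩
  have hv : 0 ≤ v := by linarith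
  rw [← sub_nonneg]
  ring_nf
  positivity

/-- Lemma C.6. -/
theorem sech_bound (x : ℝ) (hx : 0 < x) (n : ℕ) :
    (4 * Real.exp (x / 2) / (1 + Real.exp (x / 2)) ^ 2) ^ n
      ≤ Real.exp (-((n : ℝ) * min x (x ^ 2)) / 20) := by
  have hr : Real.exp (-((n : ℝ) * min x (x ^ 2)) / 20) =
      Real.exp (-(min x (x ^ 2) / 20)) ^ n := by
    rw [← Real.exp_nat_mul]; congr 1; ring
  rw [hr]
  refine pow_le_pow_left₀ (by positivity) ?_ n
  rw [Real.exp_neg, div_le_iff₀ (by positivity), inv_mul_eq_div, le_div_iff₀ (Real.exp_pos _)]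
  rcases le_total x 1 with h | h
  · rw [min_eq_right (by nlinarith)]
    have h1 := Real.exp_le_one_add_five_quarters_mul (s := x ^ 2 / 20) (by positivity)
      (by nlinarith)
    nlinarith [Real.sq_add_four_mul_exp_le x hx.le,
      mul_le_mul_of_nonneg_left h1 (Real.exp_pos (x / 2)).le]
  · rw [min_eq_left (by nlinarith)]
    have hE : Real.exp (x / 2) = Real.exp (x / 20) ^ 10 := by
      rw [← Real.exp_nat_mul]; congr 1; push_cast; ring
    have hw := four_mul_pow_eleven_le (w := Real.exp (x / 20))
      (by linarith [Real.add_one_le_exp (x / 20)])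
    rw [hE]
    linarith [hw, pow_succ (Real.exp (x / 20)) 10]
end
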